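/- For disjunctive systems, |B| + |G| + k is a cutoff for the class of k-indexed LTL\X properties under unconditionally fair executions, where G = G_A ∪ G_B is the set of non-trivial guards of the templates. -/

import Mathlib

namespace GP

/-- A process template: an initial state and a guarded transition relation.
`Gd` is the type of guards. -/
structure Template (Q Sig Gd : Type) where
  init : Q
  trans : Set (Q × Sig × Gd × Q)

variable {QA QB SA SB Gd : Type}

/-- Processes of `(A,B)^{(1,n)}`: `none` is the `A`-process, `some i` is `B_i`. -/
abbrev Proc (n : ℕ) := Option (Fin n)
/-- A global state. -/
abbrev GState (QA QB : Type) (n : ℕ) := QA × (Fin n → QB)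
/-- A global input. -/
abbrev GInput (SA SB : Type) (n : ℕ) := SA × (Fin n → SB)

/-- The local state of process `p` in global state `s`. -/
def view {n : ℕ} (s : GState QA QB n) : Proc n → QA ⊕ QB
  | none => Sum.inl s.1
  | some i => Sum.inr (s.2 i)

/-- The local input of process `p` in global input `e`. -/
def inp {n : ℕ} (e : GInput SA SB n) : Proc n → SA ⊕ SB
  | none => Sum.inl e.1
  | some i => Sum.inr (e.2 i)

/-- The set of local states of the processes other than `p`. -/
def others {n : ℕ} (s : GState QA QB n) (p : Proc n) : Set (QA ⊕ QB) :=
  {x | ∃ p', p' ≠ p ∧ view s p' = x}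

/-- Disjunctive interpretation of guards: some other process is in the guard. -/
def disjSat (S : Set (QA ⊕ QB)) (g : Set (QA ⊕ QB)) : Prop := ∃ x ∈ S, x ∈ g
/-- Conjunctive interpretation of guards: every other process is in the guard. -/
def conjSat (S : Set (QA ⊕ QB)) (g : Set (QA ⊕ QB)) : Prop := ∀ x ∈ S, x ∈ g
/-- Conjunction-of-disjunctive-guards interpretation: a guard is a finite set of
disjunctive conjuncts, each of which must be witnessed by some other process. -/
def cdSat (S : Set (QA ⊕ QB)) (g : Set (Set (QA ⊕ QB))) : Prop := ∀ D ∈ g, ∃ x ∈ S, x ∈ D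

section System

variable (A : Template QA SA Gd) (B : Template QB SB Gd)
variable (sat : Set (QA ⊕ QB) → Gd → Prop)

/-- Process `p` is enabled for global state `s` and input `e`. -/
def enabled {n : ℕ} (s : GState QA QB n) (e : GInput SA SB n) : Proc n → Prop
  | none => ∃ g q', (s.1, e.1, g, q') ∈ A.trans ∧ sat (others s none) g
  | some i => ∃ g q', (s.2 i, e.2 i, g, q') ∈ B.trans ∧ sat (others s (some i)) g

/-- One interleaving step of the system, performed by process `p`. -/
def step {n : ℕ} (s : GState QA QB n) (e : GInput SA SB n) : Proc n → GState QA QB n → Prop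
  | none, s' => ∃ g q', (s.1, e.1, g, q') ∈ A.trans ∧ sat (others s none) g ∧ s' = (q', s.2)
  | some i, s' => ∃ g q', (s.2 i, e.2 i, g, q') ∈ B.trans ∧ sat (others s (some i)) g ∧
      s' = (s.1, Function.update s.2 i q')

/-- The global initial state. -/
def isInit {n : ℕ} (s : GState QA QB n) : Prop := s.1 = A.init ∧ ∀ i, s.2 i = B.init

/-- An infinite run of `(A,B)^{(1,n)}`: at each moment `t` process `mv t` makes a step,
and the input of a process stays unchanged until that process moves. -/
structure Run (n : ℕ) where
  s : ℕ → GState QA QB n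
  e : ℕ → GInput SA SB n
  mv : ℕ → Proc n
  isInit0 : isInit A B (s 0)
  steps : ∀ t, step A B sat (s t) (e t) (mv t) (s (t + 1))
  persist : ∀ t p, p ≠ mv t → inp (e (t + 1)) p = inp (e t) p

/-- The run `x` is locally deadlocked for process `p`. -/
def lockedFrom {n : ℕ} (x : Run A B sat n) (p : Proc n) : Prop :=
  ∃ t0, ∀ t ≥ t0, ¬ enabled A B sat (x.s t) (x.e t) p

/-- The run `x` is locally deadlocked for the `B`-process `i`, which is stuck in state `q`. -/
def lockedInState {n : ℕ} (x : Run A B sat n) (i : Fin n) (q : QB) : Prop :=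
  ∃ t0, ∀ t ≥ t0, ¬ enabled A B sat (x.s t) (x.e t) (some i) ∧ (x.s t).2 i = q

/-- `(A,B)^{(1,n)}` has a local deadlock. -/
def hasLocalDeadlock (n : ℕ) : Prop :=
  ∃ x : Run A B sat n, ∃ p, lockedFrom A B sat x p

/-- `(A,B)^{(1,n)}` has a global deadlock: a finite maximal path (a finite run) ending
in a configuration where no process is enabled. -/
def hasGlobalDeadlock (n : ℕ) : Prop :=
  ∃ (m : ℕ) (s : ℕ → GState QA QB n) (e : ℕ → GInput SA SB n) (mv : ℕ → Proc n),
    isInit A B (s 0) ∧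
    (∀ t < m, step A B sat (s t) (e t) (mv t) (s (t + 1))) ∧
    (∀ t < m, ∀ p, p ≠ mv t → inp (e (t + 1)) p = inp (e t) p) ∧
    ∀ p, ¬ enabled A B sat (s m) (e m) p

/-- Unconditional fairness: every process moves infinitely often. -/
def uncondFair {n : ℕ} (x : Run A B sat n) : Prop :=
  ∀ p, ∀ t, ∃ t' ≥ t, x.mv t' = p

/-- Strong fairness: every process enabled infinitely often moves infinitely often. -/
def strongFair {n : ℕ} (x : Run A B sat n) : Prop :=
  ∀ p, (∀ t, ∃ t' ≥ t, enabled A B sat (x.s t') (x.e t') p) → (∀ t, ∃ t' ≥ t, x.mv t' = p)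

/-- Initializing run: every process that moves infinitely often visits its
initial state infinitely often. -/
def initializing {n : ℕ} (x : Run A B sat n) : Prop :=
  ∀ p, (∀ t, ∃ t' ≥ t, x.mv t' = p) →
    ∀ t, ∃ t' ≥ t, view (x.s t') p = (match p with
      | none => Sum.inl A.init
      | some _ => Sum.inr B.init)

end System

/-- LTL without the next-time operator (`LTL\X`). -/
inductive LTL (P : Type) : Type
  | atom : P → LTL P
  | tru : LTL P
  | not : LTL P → LTL P
  | and : LTL P → LTL P → LTL P
  | untl : LTL P → LTL P → LTL P

/-- Semantics of `LTL\X` over a trace `w` of valuations. -/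
def LTL.holds {P : Type} (w : ℕ → P → Prop) : LTL P → ℕ → Prop
  | .atom a, t => w t a
  | .tru, _ => True
  | .not f, t => ¬ LTL.holds w f t
  | .and f g, t => LTL.holds w f t ∧ LTL.holds w g t
  | .untl f g, t => ∃ t', t ≤ t' ∧ LTL.holds w g t' ∧ ∀ u, t ≤ u → u < t' → LTL.holds w f u

/-- Atomic propositions of a `k`-indexed formula `h(A, B_{i_1}, …, B_{i_k})`:
states/inputs of `A` and indexed states/inputs of `k` `B`-processes. -/
abbrev AtomK (QA SA QB SB : Type) (k : ℕ) := (QA ⊕ SA) ⊕ ((QB ⊕ SB) × Fin k)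

section Spec

variable (A : Template QA SA Gd) (B : Template QB SB Gd)
variable (sat : Set (QA ⊕ QB) → Gd → Prop)

/-- The trace of valuations of the atomic propositions along run `x`, where the `k`
indexed `B`-processes are given by `ι`. -/
def traceK {n k : ℕ} (x : Run A B sat n) (ι : Fin k → Fin n) :
    ℕ → AtomK QA SA QB SB k → Prop := fun t a =>
  match a with
  | Sum.inl (Sum.inl qa) => (x.s t).1 = qa
  | Sum.inl (Sum.inr sa) => (x.e t).1 = sa
  | Sum.inr (Sum.inl qb, i) => (x.s t).2 (ι i) = qb
  | Sum.inr (Sum.inr sb, i) => (x.e t).2 (ι i) = sb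

/-- `(A,B)^{(1,n)} ⊨ ∀ i_1,…,i_k. E h`, relative to a fairness constraint `F` on runs. -/
def satE (k n : ℕ) (F : Run A B sat n → Prop) (h : LTL (AtomK QA SA QB SB k)) : Prop :=
  ∀ ι : Fin k ↪ Fin n, ∃ x : Run A B sat n, F x ∧ LTL.holds (traceK A B sat x ι) h 0

/-- `(A,B)^{(1,n)} ⊨ ∀ i_1,…,i_k. A h`, relative to a fairness constraint `F` on runs. -/
def satA (k n : ℕ) (F : Run A B sat n → Prop) (h : LTL (AtomK QA SA QB SB k)) : Prop :=
  ∀ ι : Fin k ↪ Fin n, ∀ x : Run A B sat n, F x → LTL.holds (traceK A B sat x ι) h 0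

/-- `c` is a cutoff for `k`-indexed `LTL\X` properties (w.r.t. fairness `F`). -/
def kCutoff (F : ∀ n, Run A B sat n → Prop) (k c : ℕ) : Prop :=
  ∀ (h : LTL (AtomK QA SA QB SB k)) (n : ℕ), c ≤ n →
    ((satE A B sat k n (F n) h ↔ satE A B sat k c (F c) h) ∧
     (satA A B sat k n (F n) h ↔ satA A B sat k c (F c) h))

end Spec

/-- All guards appearing in transitions of a template. -/
def guardsOf {Q Sig Gd : Type} (T : Template Q Sig Gd) : Set Gd :=
  {g | ∃ q σ q', (q, σ, g, q') ∈ T.trans}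

/-- The non-trivial guards of a template (different from `Q_A ∪ Q_B` and `∅`). -/
def ntGuards {Q Sig St : Type} (T : Template Q Sig (Set St)) : Set (Set St) :=
  {g | g ∈ guardsOf T ∧ g ≠ Set.univ ∧ g ≠ ∅}

/-- `|G| = |G_A ∪ G_B|`, the number of non-trivial guards of the system. -/
noncomputable def numG (A : Template QA SA (Set (QA ⊕ QB))) (B : Template QB SB (Set (QA ⊕ QB))) : ℕ :=
  (ntGuards A ∪ ntGuards B).ncard

/-- `Enable_q`: the states of `A` and `B` that enable some transition from `q` in `B`. -/
def EnableSet (B : Template QB SB (Set (QA ⊕ QB))) (q : QB) : Set (QA ⊕ QB) :=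
  {x | ∃ σ g q'', (q, σ, g, q'') ∈ B.trans ∧ x ∈ g}

section Conj

variable (A : Template QA SA (Set (QA ⊕ QB))) (B : Template QB SB (Set (QA ⊕ QB)))

/-- The standing assumption on conjunctive systems: `init_A` and `init_B`
are contained in all guards. -/
def conjInitAssumption : Prop :=
  ∀ g ∈ guardsOf A ∪ guardsOf B, Sum.inl A.init ∈ g ∧ Sum.inr B.init ∈ g

/-- The guards of the transitions from a local state of the system. -/
def guardsFrom : QA ⊕ QB → Set (Set (QA ⊕ QB))
  | Sum.inl q => {g | ∃ σ q', (q, σ, g, q') ∈ A.trans}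
  | Sum.inr q => {g | ∃ σ q', (q, σ, g, q') ∈ B.trans}

/-- `D` is a deadset of state `st` (contains at most one `A`-state, hits every guard of a
transition from `st`, and each of its members violates some guard from `st`). -/
def IsDeadset (st : QA ⊕ QB) (D : Set (QA ⊕ QB)) : Prop :=
  (∀ x ∈ D, ∀ y ∈ D, x.isLeft → y.isLeft → x = y) ∧
  (∀ g ∈ guardsFrom A B st, ∃ x ∈ D, x ∉ g) ∧
  (∀ x ∈ D, ∃ g ∈ guardsFrom A B st, x ∉ g)

/-- A state is free if it has no deadset. -/
def IsFreeState (st : QA ⊕ QB) : Prop := ¬ ∃ D, IsDeadset A B st D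

/-- A state is non-blocking if it appears in no deadset of any state. -/
def IsNonBlocking (x : QA ⊕ QB) : Prop := ∀ st D, IsDeadset A B st D → x ∉ D

/-- A state is not self-blocking if it appears in no deadset of itself. -/
def IsNotSelfBlocking (st : QA ⊕ QB) : Prop := ∀ D, IsDeadset A B st D → st ∉ D

/-- A locally deadlocked run that is alternation-free: eventually one single deadset of the
deadlocked state remains covered forever (no infinite alternation between deadsets). -/
def altFreeLockedRun {n : ℕ} (x : Run A B conjSat n) (p : Proc n) : Prop :=
  ∃ t0 D, (∀ t ≥ t0, ¬ enabled A B conjSat (x.s t) (x.e t) p) ∧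
    IsDeadset A B (view (x.s t0) p) D ∧ ∀ t ≥ t0, D ⊆ others (x.s t) p

end Conj

section UProps

variable {QU SU : Type}
variable (U : Template QU SU (Set (QA ⊕ QB))) (emb : QU → QA ⊕ QB)

/-- Guards of transitions from state `q` of template `U`. -/
def uGFrom (q : QU) : Set (Set (QA ⊕ QB)) := {g | ∃ σ q', (q, σ, g, q') ∈ U.trans}

/-- A deadset of state `q` of template `U`. -/
def uDeadset (q : QU) (D : Set (QA ⊕ QB)) : Prop :=
  (∀ x ∈ D, ∀ y ∈ D, x.isLeft → y.isLeft → x = y) ∧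
  (∀ g ∈ uGFrom U q, ∃ x ∈ D, x ∉ g) ∧
  (∀ x ∈ D, ∃ g ∈ uGFrom U q, x ∉ g)

/-- A state of `U` is free if it has no deadset. -/
def uFreeState (q : QU) : Prop := ¬ ∃ D, uDeadset U q D

/-- A `1`-conjunctive guard excludes exactly one state. -/
def OneConjGuard (g : Set (QA ⊕ QB)) : Prop := ∃ x : QA ⊕ QB, g = {x}ᶜ

/-- A state is `1`-conjunctive if all its non-trivial guards are `1`-conjunctive. -/
def uOneConjState (q : QU) : Prop :=
  ∀ g ∈ uGFrom U q, g ≠ Set.univ → g ≠ ∅ → OneConjGuard g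

/-- A template is `1`-conjunctive if all its states are. -/
def uOneConj : Prop := ∀ q : QU, uOneConjState U q

/-- Effectively `1`-conjunctive: every state is `1`-conjunctive or free. -/
def uEff1Conj : Prop := ∀ q : QU, uOneConjState U q ∨ uFreeState U q

/-- Transitions of `U`, as quadruples. -/
abbrev Edge (QU SU St : Type) := QU × SU × Set St × QU

def esrc {St : Type} (e : Edge QU SU St) : QU := e.1
def etgt {St : Type} (e : Edge QU SU St) : QU := e.2.2.2
def egrd {St : Type} (e : Edge QU SU St) : Set St := e.2.2.1

/-- A connected sequence of transitions of `U`. -/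
def uEPath (l : List (Edge QU SU (QA ⊕ QB))) : Prop :=
  (∀ e ∈ l, e ∈ U.trans) ∧ l.Chain' (fun e e' => etgt e = esrc e')

/-- A cycle through `q`: a nonempty connected transition sequence from `q` back to `q`
visiting pairwise distinct states. -/
def uIsCycle (q : QU) (l : List (Edge QU SU (QA ⊕ QB))) : Prop :=
  l ≠ [] ∧ uEPath U l ∧
  (∃ e0 ∈ l.head?, esrc e0 = q) ∧ (∃ en ∈ l.getLast?, etgt en = q) ∧
  (l.map esrc).Nodup

/-- The states on a cycle (or transition sequence). -/
def cycStates {St : Type} (l : List (Edge QU SU St)) : Set QU := {s | ∃ e ∈ l, esrc e = s}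

/-- The guards on a cycle (or transition sequence). -/
def cycGuards {St : Type} (l : List (Edge QU SU St)) : Set (Set St) := {g | ∃ e ∈ l, egrd e = g}

/-- A lasso: a connected transition sequence starting at the initial state and
ending with a cycle. -/
def uIsLasso (l : List (Edge QU SU (QA ⊕ QB))) : Prop :=
  uEPath U l ∧ (∃ e0 ∈ l.head?, esrc e0 = U.init) ∧
  ∃ l1 l2 q, l = l1 ++ l2 ∧ uIsCycle U q l2

/-- `D` disables all `n`-conjunctive guards with `n > 1` of transitions from `q`. -/
def uDisablesBig (q : QU) (D : Set (QA ⊕ QB)) : Prop :=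
  ∀ g ∈ uGFrom U q, g ≠ Set.univ → 2 ≤ (gᶜ).ncard → ∃ x ∈ D, x ∉ g

/-- Freely traversable template: for every non-free state `q` and every set of states
disabling the `n`-conjunctive guards (`n > 1`) from `q`, there is a lasso whose guards
avoid `¬q`, avoid all `¬q_i`, and avoid all `1`-conjunctive guards from `q`. -/
def uFreelyTraversable : Prop :=
  ∀ q : QU, ¬ uFreeState U q → ∀ D, uDisablesBig U q D →
    ∃ l, uIsLasso U l ∧ ∀ g ∈ cycGuards l,
      emb q ∈ g ∧ (∀ x ∈ D, x ∈ g) ∧ ∀ x : QA ⊕ QB, ({x}ᶜ ∈ uGFrom U q) → x ∈ g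

/-- `x` has a cycle through it that is disjoint from all cycles through `q` and
whose guards never exclude `q`. -/
def uBadCycleFor (q : QU) (x : QA ⊕ QB) : Prop :=
  ∃ qx : QU, emb qx = x ∧ ∃ c, uIsCycle U qx c ∧
    (∀ s ∈ cycStates c, ¬ ∃ cq, uIsCycle U q cq ∧ s ∈ cycStates cq) ∧
    (∀ g ∈ cycGuards c, emb q ∈ g)

/-- Alternation-free template. -/
def uAltFree : Prop :=
  (∀ q : QU, ¬ uFreeState U q → ∀ D, uDisablesBig U q D →
    ∀ x ∈ D, ∀ y ∈ D, uBadCycleFor U emb q x → uBadCycleFor U emb q y → x = y) ∨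
  (∀ q : QU, ¬ uFreeState U q → ∀ g ∈ uGFrom U q, 2 ≤ (gᶜ).ncard →
    ∃ x ∈ gᶜ, {x}ᶜ ∈ uGFrom U q)

end UProps


/-! ### Stutter invariance of `LTL\X` -/

/-- `LTL\X` does not distinguish a trace from its image under a monotone surjective
reparametrization of time. -/
theorem LTL.holds_comp_iff {P : Type} {w w' : ℕ → P → Prop} {φ : ℕ → ℕ} (hm : Monotone φ)
    (hs : Function.Surjective φ) (hw : ∀ u, w u = w' (φ u)) (h : LTL P) (u : ℕ) :
    LTL.holds w h u ↔ LTL.holds w' h (φ u) := by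
  induction h generalizing u with
  | atom a => simp [LTL.holds, hw]
  | tru => simp [LTL.holds]
  | not f ih => simp [LTL.holds, ih]
  | and f g ihf ihg => simp [LTL.holds, ihf, ihg]
  | untl f g ihf ihg =>
    simp only [LTL.holds]
    constructor
    · rintro ⟨t, hut, hg, hf⟩
      refine ⟨φ t, hm hut, (ihg t).1 hg, fun v huv hvt => ?_⟩
      obtain ⟨v, rfl⟩ := hs v
      have hmax : φ (max u v) = φ v := by rw [hm.map_max]; exact max_eq_right huv
      have hlt : max u v < t := by
        by_contra! hle
        have := hm hle
        omega
      rw [← hmax]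
      exact (ihf _).1 (hf _ (le_max_left _ _) hlt)
    · rintro ⟨v, huv, hg, hf⟩
      have hex : ∃ t, u ≤ t ∧ φ t = v := by
        obtain ⟨t, rfl⟩ := hs v
        exact ⟨max u t, le_max_left _ _, by rw [hm.map_max]; exact max_eq_right huv⟩
      classical
      obtain ⟨hle, hv⟩ := Nat.find_spec hex
      refine ⟨Nat.find hex, hle, (ihg _).2 (by rwa [hv]), fun v' huv' hlt => ?_⟩
      refine (ihf _).2 (hf _ (hm huv') (lt_of_le_of_ne (hv ▸ hm hlt.le) fun heq => ?_))
      exact Nat.find_min hex hlt ⟨huv', heq⟩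

/-- Removing the idle steps of a sequence of configurations. -/
theorem exists_remove_idle {Z : Type*} (z : ℕ → Z) (W : ℕ → Prop) (hW : ∃ᶠ u in Filter.atTop, W u)
    (hidle : ∀ u, ¬ W u → z (u + 1) = z u) :
    ∃ c ν : ℕ → ℕ, Monotone c ∧ Function.Surjective c ∧ (∀ u, z u = z (ν (c u))) ∧
      (∀ v, W (ν v)) ∧ (∀ v, c (ν v) = v) ∧ (∀ v, c (ν v + 1) = v + 1) ∧
      ∀ u, W u → ν (c u) = u := by
  classical
  have hinf : (Set.ofPred W).Infinite := Nat.frequently_atTop_iff_infinite.1 hW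
  have hle : ∀ u, ∀ d, (∀ i < d, ¬ W (u + i)) → z (u + d) = z u := by
    intro u d
    induction d with
    | zero => simp
    | succ d ih =>
      intro h
      rw [← add_assoc, hidle _ (h d (by omega)), ih fun i hi => h i (by omega)]
  refine ⟨Nat.count W, Nat.nth W, Nat.count_monotone W,
    fun v => ⟨Nat.nth W v, Nat.count_nth_of_infinite hinf v⟩, fun u => ?_,
    Nat.nth_mem_of_infinite hinf, Nat.count_nth_of_infinite hinf,
    Nat.count_nth_succ_of_infinite hinf, fun u hu => Nat.nth_count hu⟩
  obtain ⟨d, hd⟩ := Nat.exists_eq_add_of_le (Nat.le_nth_count hinf u)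
  rw [hd]
  refine (hle u d fun i hi hWi => ?_).symm
  have h1 := Nat.nth_count hWi
  have h2 := Nat.nth_monotone hinf (Nat.count_monotone W (Nat.le_add_right u i))
  omega

/-! ### Local behaviour of the auxiliary copies of `B`

Below, `c u t` is the local configuration (state and input) of process `u` at time `t`, and
`mvd t u` says that `u` moves at time `t`. -/

section Plan

variable {Q S U : Type*} {c : U → ℕ → Q × S} {mvd : ℕ → U → Prop}

/-- The configurations `d` and moves `M` of a process which is built by copying moves of the
processes `u` of the original system. -/
structure Copies (c : U → ℕ → Q × S) (mvd : ℕ → U → Prop) (d : ℕ → Q × S) (M : ℕ → Prop) :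
    Prop where
  init : ∃ u, (d 0).1 = (c u 0).1
  stay : ∀ t, ¬ M t → d (t + 1) = d t
  copy : ∀ t, M t → ∃ u, mvd t u ∧ d t = c u t ∧ (d (t + 1)).1 = (c u (t + 1)).1
  fair : ∃ᶠ t in Filter.atTop, M t

open Classical in
/-- Configurations of a process that follows `f` until time `a`, and afterwards waits in
configuration `w` except for excursions (the times satisfying `E`) on which it follows `p`. -/
noncomputable def excursionCfg (c : U → ℕ → Q × S) (f p : U) (a : ℕ) (w : Q × S) (E : ℕ → Prop)
    (t : ℕ) : Q × S :=
  if t < a then c f t else if E t then c p t else w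

/-- Moves of the process of `excursionCfg`. -/
def excursionMove (mvd : ℕ → U → Prop) (f p : U) (a : ℕ) (E : ℕ → Prop) (t : ℕ) : Prop :=
  (t < a ∧ mvd t f) ∨ (E t ∧ mvd t p)

theorem copies_excursion (hstay : ∀ t u, ¬ mvd t u → c u (t + 1) = c u t)
    {f p : U} {a : ℕ} {w : Q × S} {E : ℕ → Prop}
    (ha : (c f a).1 = w.1) (hlt : ∀ t < a, (c f t).1 ≠ w.1) (hE : ∀ t, E t → a ≤ t)
    (h0 : E 0 → c p 0 = w) (hflip : ∀ t, (E (t + 1) ↔ E t) ∨ c p (t + 1) = w)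
    (hfair : ∃ᶠ t in Filter.atTop, E t ∧ mvd t p) :
    Copies c mvd (excursionCfg c f p a w E) (excursionMove mvd f p a E) := by
  have hEa : ∀ t, a = t → E t → c p t = w := by
    rintro (_ | t) hat hEt
    · exact h0 hEt
    · rcases hflip t with h | h
      · have := hE t (h.1 hEt)
        omega
      · exact h
  refine ⟨?_, fun t hM => ?_, fun t hM => ?_, hfair.mono fun t ht => Or.inr ht⟩
  · by_cases h : 0 < a
    · exact ⟨f, by simp [excursionCfg, h]⟩
    · by_cases hE0 : E 0
      · exact ⟨p, by simp [excursionCfg, h, hE0]⟩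
      · obtain rfl : a = 0 := by omega
        exact ⟨f, by simp [excursionCfg, hE0, ha]⟩
  · simp only [excursionMove, not_or, not_and] at hM
    rcases lt_trichotomy (t + 1) a with h | h | h
    · simp only [excursionCfg, h, if_true, show t < a by omega]
      exact hstay t f (hM.1 (by omega))
    · exfalso
      have h1 := hstay t f (hM.1 (by omega))
      rw [h] at h1
      exact hlt t (by omega) (h1 ▸ ha)
    · have h1 : ¬ t + 1 < a := by omega
      have h2 : ¬ t < a := by omega
      simp only [excursionCfg, h1, h2, if_false]
      have h3 := fun hEt => hstay t p (hM.2 hEt)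
      have h4 := hflip t
      split_ifs <;> grind
  · rcases hM with ⟨hta, hm⟩ | ⟨hEt, hm⟩
    · refine ⟨f, hm, by simp [excursionCfg, hta], ?_⟩
      rcases lt_or_eq_of_le (show t + 1 ≤ a from hta) with h | h
      · simp [excursionCfg, h]
      · have h1 := hEa _ h.symm
        rw [h] at h1 ⊢
        simp only [excursionCfg, lt_irrefl, if_false]
        split_ifs with h2
        · rw [h1 h2, ha]
        · exact ha.symm
    · have h1 := hE t hEt
      refine ⟨p, hm, ?_, ?_⟩
      · simp [excursionCfg, hEt, show ¬ t < a by omega]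
      · have h4 := hflip t
        simp only [excursionCfg, show ¬ t + 1 < a by omega, if_false]
        split_ifs <;> grind

/-- For each visited state `q` there are `m` local behaviours each of which waits in `q` whenever
the original system has a process waiting in `q`; if `q` is visited infinitely often, then this
is guaranteed until time `T` only, but after time `T` at most one of them does not wait in `q`. -/
theorem exists_copies [Finite S] [Finite U]
    (hstay : ∀ t u, ¬ mvd t u → c u (t + 1) = c u t)
    (hfair : ∀ u, ∃ᶠ t in Filter.atTop, mvd t u)
    {q : Q} {T : ℕ} (hT : ∃ t ≤ T, ∃ u, (c u t).1 = q) (m : ℕ) :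
    ∃ (d : Fin m → ℕ → Q × S) (M : Fin m → ℕ → Prop), (∀ j, Copies c mvd (d j) (M j)) ∧
      (∀ j t, (∃ u, (c u t).1 = q ∧ ¬ mvd t u) →
        ((∃ᶠ t in Filter.atTop, ∃ u, (c u t).1 = q) → t < T) → (d j t).1 = q ∧ ¬ M j t) ∧
      ((∃ᶠ t in Filter.atTop, ∃ u, (c u t).1 = q) → ∀ t ≥ T, ∀ j j', j ≠ j' →
        ((d j t).1 = q ∧ ¬ M j t) ∨ ((d j' t).1 = q ∧ ¬ M j' t)) := by
  classical
  have hvis : ∃ t, ∃ u, (c u t).1 = q := by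
    obtain ⟨t, -, h⟩ := hT
    exact ⟨t, h⟩
  set a := Nat.find hvis with ha
  obtain ⟨f, hf⟩ := Nat.find_spec hvis
  rw [← ha] at hf
  have hlt : ∀ t < a, (c f t).1 ≠ q := fun t ht h => Nat.find_min hvis ht ⟨f, h⟩
  have hle : ∀ t u, (c u t).1 = q → a ≤ t := fun t u h => Nat.find_min' hvis ⟨u, h⟩
  have haT : a ≤ T := by
    obtain ⟨t, htT, u, hu⟩ := hT
    exact (hle t u hu).trans htT
  have hsit : ∀ (p : U) (σ : S) (E : ℕ → Prop) (t : ℕ), a ≤ t → ¬ E t →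
      (excursionCfg c f p a (q, σ) E t).1 = q ∧ ¬ excursionMove mvd f p a E t := by
    intro p σ E t hat hEt
    simp [excursionCfg, excursionMove, hEt, show ¬ t < a by omega]
  by_cases hq : ∃ᶠ t in Filter.atTop, ∃ u, (c u t).1 = q
  · obtain ⟨p, σ, hp⟩ : ∃ p σ, ∃ᶠ t in Filter.atTop, mvd t p ∧ c p t = (q, σ) := by
      simp only [← Filter.frequently_exists]
      rw [Filter.frequently_atTop] at hq ⊢
      intro t
      obtain ⟨t₁, ht₁, u, hu⟩ := hq t
      have hex : ∃ i, mvd (t₁ + i) u := by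
        obtain ⟨t₂, ht₂, h⟩ := Filter.frequently_atTop.1 (hfair u) t₁
        exact ⟨t₂ - t₁, by rwa [Nat.add_sub_cancel' ht₂]⟩
      have hkeep : ∀ i ≤ Nat.find hex, c u (t₁ + i) = c u t₁ := by
        intro i
        induction i with
        | zero => simp
        | succ i ih =>
          intro hi
          rw [← add_assoc, hstay _ _ (Nat.find_min hex hi), ih (by omega)]
      refine ⟨t₁ + Nat.find hex, by omega, u, (c u t₁).2, Nat.find_spec hex, ?_⟩
      rw [hkeep _ le_rfl, ← hu]
    set P : ℕ → Prop := fun t => T ≤ t ∧ mvd t p ∧ c p t = (q, σ) with hP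
    have hPinf : (Set.ofPred P).Infinite := by
      refine Nat.frequently_atTop_iff_infinite.1 ?_
      exact (Filter.eventually_ge_atTop T).and_frequently hp
    set E : Fin m → ℕ → Prop := fun j t =>
      0 < Nat.count P (t + 1) ∧ Nat.count P (t + 1) % m = j with hE
    have hET : ∀ j t, E j t → T ≤ t := by
      rintro j t ⟨h, -⟩
      by_contra! hlt
      refine h.ne' ?_
      rw [Nat.count_iff_forall_not]
      rintro t' ht' ⟨h1, -⟩
      omega
    refine ⟨fun j => excursionCfg c f p a (q, σ) (E j), fun j => excursionMove mvd f p a (E j),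
      fun j => copies_excursion hstay hf hlt (fun t h => haT.trans (hET j t h)) ?_ ?_ ?_, ?_, ?_⟩
    · rintro ⟨h, -⟩
      by_cases h0 : P 0
      · exact h0.2.2
      · simp [Nat.count_succ, h0] at h
    · intro t
      by_cases h : P (t + 1)
      · exact Or.inr h.2.2
      · left
        simp only [hE, Nat.count_succ P (t + 1), h, if_false, add_zero]
    · rw [Filter.frequently_atTop]
      intro t
      obtain ⟨i, hi, him⟩ := Filter.frequently_atTop.1 (Nat.frequently_mod_eq j.2) (t + 1)
      obtain ⟨i, rfl⟩ : ∃ i', i = i' + 1 := ⟨i - 1, by omega⟩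
      have h1 := Nat.count_nth_succ_of_infinite hPinf i
      refine ⟨Nat.nth P i, ?_, ⟨by omega, by rw [h1, him]⟩,
        (Nat.nth_mem_of_infinite hPinf i).2.1⟩
      have := (Nat.nth_strictMono hPinf).le_apply (x := i)
      omega
    · rintro j t ⟨u, hu, -⟩ h
      refine hsit _ _ _ _ (hle t u hu) fun hEt => ?_
      have := hET j t hEt
      have := h hq
      omega
    · intro _ t ht j j' hne
      by_cases hEj : E j t
      · refine Or.inr (hsit _ _ _ _ (haT.trans ht) fun hEj' => hne ?_)
        exact Fin.ext (hEj.2.symm.trans hEj'.2)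
      · exact Or.inl (hsit _ _ _ _ (haT.trans ht) hEj)
  · have hev : ∃ L, ∀ t ≥ L, ∀ u, (c u t).1 ≠ q := by
      rw [Filter.not_frequently, Filter.eventually_atTop] at hq
      simpa using hq
    have hpos : Nat.find hev ≠ 0 := by
      intro h0
      obtain ⟨t, u, hu⟩ := hvis
      exact Nat.find_spec hev t (by omega) u hu
    obtain ⟨L, hL⟩ := Nat.exists_eq_succ_of_ne_zero hpos
    have hLspec : ∀ t ≥ L + 1, ∀ u, (c u t).1 ≠ q := by
      have := Nat.find_spec hev
      rwa [hL] at this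
    obtain ⟨p, hp⟩ : ∃ p, (c p L).1 = q := by
      by_contra! hno
      refine Nat.find_min hev (m := L) (by omega) fun t ht u => ?_
      rcases eq_or_lt_of_le ht with rfl | h
      · exact hno u
      · exact hLspec t h u
    refine ⟨fun _ => excursionCfg c f p a (q, (c p L).2) (L ≤ ·),
      fun _ => excursionMove mvd f p a (L ≤ ·),
      fun _ => copies_excursion hstay hf hlt (fun t h => (hle L p hp).trans h) ?_ ?_ ?_, ?_,
      fun h => absurd h hq⟩
    · intro h
      obtain rfl : L = 0 := by omega
      rw [← hp]
    · intro t
      by_cases h : t + 1 = L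
      · right
        rw [h, ← hp]
      · left
        omega
    · exact (Filter.eventually_ge_atTop L).and_frequently (hfair p)
    · rintro - t ⟨u, hu, hmu⟩ -
      refine hsit _ _ _ _ (hle t u hu) fun hLt => hLspec (t + 1) (by omega) u ?_
      rw [hstay t u hmu, hu]

end Plan

/-! ### Serializing simultaneous moves -/

/-- The local transitions of both templates, on the disjoint unions of states and inputs. -/
def localTrans (A : Template QA SA Gd) (B : Template QB SB Gd) :
    QA ⊕ QB → SA ⊕ SB → Gd → QA ⊕ QB → Prop
  | Sum.inl q, Sum.inl σ, g, Sum.inl q' => (q, σ, g, q') ∈ A.trans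
  | Sum.inr q, Sum.inr σ, g, Sum.inr q' => (q, σ, g, q') ∈ B.trans
  | _, _, _, _ => False

theorem step_iff {A : Template QA SA Gd} {B : Template QB SB Gd} {sat : Set (QA ⊕ QB) → Gd → Prop}
    {n : ℕ} {s s' : GState QA QB n} {e : GInput SA SB n} {p : Proc n} :
    step A B sat s e p s' ↔ (∃ g, localTrans A B (view s p) (inp e p) g (view s' p) ∧
      sat (others s p) g) ∧ ∀ p' ≠ p, view s' p' = view s p' := by
  obtain ⟨a, b⟩ := s
  obtain ⟨a', b'⟩ := s'
  rcases p with _ | i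
  · simp only [step, view, inp, localTrans]
    constructor
    · rintro ⟨g, q', h, hs, heq⟩
      obtain ⟨rfl, rfl⟩ := Prod.mk.inj heq
      refine ⟨⟨g, h, hs⟩, ?_⟩
      rintro (_ | j) hj
      · exact absurd rfl hj
      · rfl
    · rintro ⟨⟨g, h, hs⟩, hrest⟩
      refine ⟨g, a', h, hs, Prod.ext rfl (funext fun j => ?_)⟩
      simpa [view] using hrest (some j) (by simp)
  · simp only [step, view, inp, localTrans]
    constructor
    · rintro ⟨g, q', h, hs, heq⟩
      obtain ⟨rfl, rfl⟩ := Prod.mk.inj heq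
      refine ⟨⟨g, by simpa using h, hs⟩, ?_⟩
      rintro (_ | j) hj
      · rfl
      · simp [show j ≠ i by simpa using hj]
    · rintro ⟨⟨g, h, hs⟩, hrest⟩
      refine ⟨g, b' i, h, hs, Prod.ext ?_ (funext fun j => ?_)⟩
      · simpa [view] using hrest none (by simp)
      · by_cases hj : j = i
        · subst hj
          simp
        · simpa [hj] using hrest (some j) (by simpa using hj)

open Classical in
/-- The global state which agrees with `s'` on the processes in `D` and with `s` elsewhere. -/
noncomputable def mixState {X Y : Type} {n : ℕ} (D : Proc n → Prop) (s s' : X × (Fin n → Y)) :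
    X × (Fin n → Y) :=
  (if D none then s'.1 else s.1, fun i => if D (some i) then s'.2 i else s.2 i)

open Classical in
theorem view_mixState {n : ℕ} (D : Proc n → Prop) (s s' : GState QA QB n) (p : Proc n) :
    view (mixState D s s') p = if D p then view s' p else view s p := by
  rcases p with _ | i <;> simp only [view, mixState] <;> split_ifs <;> rfl

open Classical in
theorem inp_mixState {n : ℕ} (D : Proc n → Prop) (e e' : GInput SA SB n) (p : Proc n) :
    inp (mixState D e e') p = if D p then inp e' p else inp e p := by
  rcases p with _ | i <;> simp only [inp, mixState] <;> split_ifs <;> rfl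

theorem view_ext {n : ℕ} {s s' : GState QA QB n} (h : ∀ p, view s p = view s' p) : s = s' := by
  refine Prod.ext ?_ (funext fun i => ?_)
  · simpa [view] using h none
  · simpa [view] using h (some i)

theorem inp_ext {n : ℕ} {e e' : GInput SA SB n} (h : ∀ p, inp e p = inp e' p) : e = e' := by
  refine Prod.ext ?_ (funext fun i => ?_)
  · simpa [inp] using h none
  · simpa [inp] using h (some i)

/-- The valuation of the atomic propositions in a global configuration. -/
def obs {n k : ℕ} (ι : Fin k → Fin n) (z : GState QA QB n × GInput SA SB n) :
    AtomK QA SA QB SB k → Prop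
  | Sum.inl (Sum.inl qa) => z.1.1 = qa
  | Sum.inl (Sum.inr sa) => z.2.1 = sa
  | Sum.inr (Sum.inl qb, i) => z.1.2 (ι i) = qb
  | Sum.inr (Sum.inr sb, i) => z.2.2 (ι i) = sb

theorem traceK_eq_obs {A : Template QA SA Gd} {B : Template QB SB Gd}
    {sat : Set (QA ⊕ QB) → Gd → Prop} {n k : ℕ} (x : Run A B sat n) (ι : Fin k → Fin n) (t : ℕ) :
    traceK A B sat x ι t = obs ι (x.s t, x.e t) := by
  funext a
  rcases a with (a | a) | ⟨a | a, i⟩ <;> rfl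

/-- The processes observed by a `k`-indexed formula. -/
def Watched {n k : ℕ} (ι : Fin k → Fin n) (p : Proc n) : Prop := p = none ∨ ∃ i, p = some (ι i)

theorem obs_congr {n n' k : ℕ} {ι : Fin k → Fin n} {ι' : Fin k → Fin n'}
    {z : GState QA QB n × GInput SA SB n} {z' : GState QA QB n' × GInput SA SB n'}
    (hA : z.1.1 = z'.1.1 ∧ z.2.1 = z'.2.1)
    (hB : ∀ i, z.1.2 (ι i) = z'.1.2 (ι' i) ∧ z.2.2 (ι i) = z'.2.2 (ι' i)) :
    obs ι z = obs ι' z' := by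
  funext a
  rcases a with (a | a) | ⟨a | a, i⟩ <;> simp [obs, hA, hB]

theorem obs_congr_watched {n k : ℕ} {ι : Fin k → Fin n}
    {z z' : GState QA QB n × GInput SA SB n}
    (h : ∀ p, Watched ι p → view z.1 p = view z'.1 p ∧ inp z.2 p = inp z'.2 p) :
    obs ι z = obs ι z' := by
  refine obs_congr ?_ fun i => ?_
  · simpa [view, inp] using h none (Or.inl rfl)
  · simpa [view, inp] using h (some (ι i)) (Or.inr ⟨i, rfl⟩)

/-- A sequence of configurations in which a set of processes moves simultaneously, such that all
guards are satisfied by processes which do not move and at most one observed process moves at each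
time, can be turned into an unconditionally fair run satisfying the same formulas. -/
theorem exists_run_of_simultaneous {A : Template QA SA (Set (QA ⊕ QB))}
    {B : Template QB SB (Set (QA ⊕ QB))} {m k : ℕ} (ι : Fin k → Fin m)
    (z : ℕ → GState QA QB m × GInput SA SB m) (M : ℕ → Proc m → Prop)
    (hinit : isInit A B (z 0).1)
    (hstay : ∀ t p, ¬ M t p → view (z (t + 1)).1 p = view (z t).1 p ∧
      inp (z (t + 1)).2 p = inp (z t).2 p)
    (hmove : ∀ t p, M t p → ∃ g, localTrans A B (view (z t).1 p) (inp (z t).2 p) g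
      (view (z (t + 1)).1 p) ∧ ∃ p', ¬ M t p' ∧ view (z t).1 p' ∈ g)
    (hfair : ∀ p, ∃ᶠ t in Filter.atTop, M t p)
    (hwatch : ∀ t p p', Watched ι p → Watched ι p' → M t p → M t p' → p = p') :
    ∃ y : Run A B disjSat m, uncondFair A B disjSat y ∧
      ∀ h, LTL.holds (traceK A B disjSat y ι) h 0 ↔ LTL.holds (fun t => obs ι (z t)) h 0 := by
  classical
  obtain ⟨N, hNpos, ⟨idx⟩⟩ : ∃ N, 0 < N ∧ Nonempty (Proc m ≃ Fin N) :=
    ⟨Fintype.card (Proc m), Fintype.card_pos, ⟨Fintype.equivFin _⟩⟩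
  set slot : ℕ → Proc m := fun u => idx.symm ⟨u % N, Nat.mod_lt _ hNpos⟩ with hslot
  have hslot_iff : ∀ u p, slot u = p ↔ (idx p : ℕ) = u % N := by
    intro u p
    simp only [hslot, Equiv.symm_apply_eq, Fin.ext_iff]
    exact eq_comm
  set D : ℕ → Proc m → Prop := fun u p => (idx p : ℕ) < u % N with hD
  set z' : ℕ → GState QA QB m × GInput SA SB m := fun u =>
    (mixState (D u) (z (u / N)).1 (z (u / N + 1)).1,
      mixState (D u) (z (u / N)).2 (z (u / N + 1)).2) with hz'
  set W : ℕ → Prop := fun u => M (u / N) (slot u) with hW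
  have hnext : ∀ u p, p ≠ slot u → view (z' (u + 1)).1 p = view (z' u).1 p ∧
      inp (z' (u + 1)).2 p = inp (z' u).2 p := by
    intro u p hp
    have hne : (idx p : ℕ) ≠ u % N := fun h => hp ((hslot_iff u p).2 h).symm
    have hlt := (idx p).2
    simp only [hz', view_mixState, inp_mixState, hD]
    by_cases hdvd : N ∣ u + 1
    · have h1 := Nat.succ_div_of_dvd hdvd
      have h2 : (u + 1) % N = 0 := Nat.mod_eq_zero_of_dvd hdvd
      have h3 : u % N + 1 = N := by
        have := Nat.div_add_mod u N
        have := Nat.div_add_mod (u + 1) N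
        rw [h1, h2] at this
        have : N * (u / N + 1) = N * (u / N) + N := by ring
        omega
      rw [h1, h2]
      simp [show (idx p : ℕ) < u % N by omega]
    · have h1 := Nat.succ_div_of_not_dvd hdvd
      have h2 : (u + 1) % N = u % N + 1 := by
        have := Nat.div_add_mod u N
        have := Nat.div_add_mod (u + 1) N
        rw [h1] at this
        omega
      rw [h1, h2]
      simp [show (idx p : ℕ) < u % N + 1 ↔ (idx p : ℕ) < u % N by omega]
  have hslotz : ∀ u, view (z' u).1 (slot u) = view (z (u / N)).1 (slot u) ∧
      inp (z' u).2 (slot u) = inp (z (u / N)).2 (slot u) := by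
    intro u
    have h := (hslot_iff u (slot u)).1 rfl
    simp [hz', view_mixState, inp_mixState, hD, h]
  have hslotz' : ∀ u, view (z' (u + 1)).1 (slot u) = view (z (u / N + 1)).1 (slot u) ∧
      inp (z' (u + 1)).2 (slot u) = inp (z (u / N + 1)).2 (slot u) := by
    intro u
    have h := (hslot_iff u (slot u)).1 rfl
    simp only [hz', view_mixState, inp_mixState, hD]
    by_cases hdvd : N ∣ u + 1
    · rw [Nat.succ_div_of_dvd hdvd, Nat.mod_eq_zero_of_dvd hdvd]
      simp
    · have h1 := Nat.succ_div_of_not_dvd hdvd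
      have h2 : (u + 1) % N = u % N + 1 := by
        have := Nat.div_add_mod u N
        have := Nat.div_add_mod (u + 1) N
        rw [h1] at this
        omega
      rw [h1, h2]
      simp [h]
  have hwait : ∀ u p, ¬ M (u / N) p → view (z' u).1 p = view (z (u / N)).1 p ∧
      inp (z' u).2 p = inp (z (u / N)).2 p := by
    intro u p hp
    obtain ⟨h1, h2⟩ := hstay _ _ hp
    simp [hz', view_mixState, inp_mixState, h1, h2]
  have hstep : ∀ u, W u → step A B disjSat (z' u).1 (z' u).2 (slot u) (z' (u + 1)).1 := by
    intro u hu
    obtain ⟨g, hg, p', hp', hpg⟩ := hmove _ _ hu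
    refine step_iff.2 ⟨⟨g, ?_, view (z (u / N)).1 p', ⟨p', ?_, (hwait u p' hp').1⟩, hpg⟩,
      fun p hp => (hnext u p hp).1⟩
    · rwa [(hslotz u).1, (hslotz u).2, (hslotz' u).1]
    · rintro rfl
      exact hp' hu
  have hidle : ∀ u, ¬ W u → z' (u + 1) = z' u := by
    intro u hu
    have key : ∀ p, view (z' (u + 1)).1 p = view (z' u).1 p ∧
        inp (z' (u + 1)).2 p = inp (z' u).2 p := by
      intro p
      by_cases hp : p = slot u
      · subst hp
        rw [(hslotz u).1, (hslotz u).2, (hslotz' u).1, (hslotz' u).2]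
        exact hstay _ _ hu
      · exact hnext u p hp
    exact Prod.ext (view_ext fun p => (key p).1) (inp_ext fun p => (key p).2)
  have hWfair : ∀ p, ∃ᶠ u in Filter.atTop, W u ∧ slot u = p := by
    intro p
    rw [Filter.frequently_atTop]
    intro u
    obtain ⟨t, ht, hM⟩ := Filter.frequently_atTop.1 (hfair p) u
    have hp := (idx p).2
    have hdiv : (N * t + idx p) / N = t := by
      rw [Nat.mul_add_div hNpos, Nat.div_eq_of_lt hp, add_zero]
    have hsl : slot (N * t + idx p) = p :=
      (hslot_iff _ _).2 (by rw [Nat.mul_add_mod, Nat.mod_eq_of_lt hp])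
    refine ⟨N * t + idx p, ?_, ?_, hsl⟩
    · have := Nat.le_mul_of_pos_left t hNpos
      omega
    · simp only [hW, hsl, hdiv, hM]
  obtain ⟨c, ν, hcm, hcs, hzc, hWν, hcν, hcν', hνc⟩ :=
    exists_remove_idle z' W ((hWfair none).mono fun _ h => h.1) hidle
  have hz0 : z' 0 = z 0 := by
    have key : ∀ p, view (z' 0).1 p = view (z 0).1 p ∧ inp (z' 0).2 p = inp (z 0).2 p := by
      intro p
      simp [hz', view_mixState, inp_mixState, hD]
    exact Prod.ext (view_ext fun p => (key p).1) (inp_ext fun p => (key p).2)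
  have hsucc : ∀ v, z' (ν (v + 1)) = z' (ν v + 1) := by
    intro v
    rw [hzc (ν v + 1), hcν']
  have hc0 : c 0 = 0 := by
    obtain ⟨u, hu⟩ := hcs 0
    have := hcm (Nat.zero_le u)
    omega
  let y : Run A B disjSat m :=
    { s := fun v => (z' (ν v)).1
      e := fun v => (z' (ν v)).2
      mv := fun v => slot (ν v)
      isInit0 := by
        have h := hzc 0
        rw [hc0] at h
        rwa [← h, hz0]
      steps := fun v => by
        rw [hsucc]
        exact hstep _ (hWν v)
      persist := fun v p hp => by
        rw [hsucc]
        exact (hnext _ _ hp).2 }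
  refine ⟨y, fun p v => ?_, fun h => ?_⟩
  · obtain ⟨u, hu, hWu, hsl⟩ := Filter.frequently_atTop.1 (hWfair p) (ν v)
    refine ⟨c u, ?_, ?_⟩
    · have := hcm hu
      rwa [hcν] at this
    · show slot (ν (c u)) = p
      rw [hνc u hWu, hsl]
  · have h1 := LTL.holds_comp_iff (w := fun u => obs ι (z' u)) (w' := traceK A B disjSat y ι)
      hcm hcs (fun u => by rw [traceK_eq_obs]; exact congrArg (obs ι) (hzc u)) h 0
    set moved : ℕ → Prop := fun u => ∃ p, Watched ι p ∧ M (u / N) p ∧ D u p with hmoved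
    set φ : ℕ → ℕ := fun u => u / N + if moved u then 1 else 0 with hφ
    have hφm : Monotone φ := by
      intro u u' huu'
      rcases lt_or_eq_of_le (Nat.div_le_div_right (c := N) huu') with hlt | heq
      · simp only [hφ]
        split_ifs <;> omega
      · have himp : moved u → moved u' := by
          rintro ⟨p, hp, hM, hDp⟩
          refine ⟨p, hp, heq ▸ hM, ?_⟩
          have := Nat.div_add_mod u N
          have := Nat.div_add_mod u' N
          rw [← heq] at this
          simp only [hD] at hDp ⊢
          omega
        by_cases hu : moved u
        · simp [hφ, heq, hu, himp hu]
        · simp [hφ, heq, hu]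
    have hφN : ∀ t, φ (N * t) = t := by
      intro t
      simp [hφ, hmoved, hD, hNpos]
    have hobs : ∀ u, obs ι (z' u) = obs ι (z (φ u)) := by
      intro u
      refine obs_congr_watched fun p hp => ?_
      simp only [hz', view_mixState, inp_mixState, hφ]
      by_cases hmv : moved u
      · simp only [hmv, if_true]
        by_cases hDp : D u p
        · simp [hDp]
        · obtain ⟨p₀, hp₀, hM₀, hD₀⟩ := hmv
          have hMp : ¬ M (u / N) p := fun hM => hDp (hwatch _ _ _ hp hp₀ hM hM₀ ▸ hD₀)
          obtain ⟨h1, h2⟩ := hstay _ _ hMp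
          simp [h1, h2]
      · simp only [hmv, if_false, add_zero]
        by_cases hDp : D u p
        · have hMp : ¬ M (u / N) p := fun hM => hmv ⟨p, hp, hM, hDp⟩
          obtain ⟨h1, h2⟩ := hstay _ _ hMp
          simp [h1, h2]
        · simp [hDp]
    have h2 := LTL.holds_comp_iff (w := fun u => obs ι (z' u)) (w' := fun t => obs ι (z t))
      hφm (fun t => ⟨N * t, hφN t⟩) hobs h 0
    have hφ0 : φ 0 = 0 := by simpa using hφN 0
    rw [hφ0] at h2
    rw [hc0] at h1
    exact h1.symm.trans h2

/-! ### The cutoff -/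

theorem localTrans.mem_guardsOf {A : Template QA SA Gd} {B : Template QB SB Gd}
    {q q' : QA ⊕ QB} {σ : SA ⊕ SB} {g : Gd} (h : localTrans A B q σ g q') :
    g ∈ guardsOf A ∪ guardsOf B := by
  rcases q with q | q <;> rcases σ with σ | σ <;> rcases q' with q' | q' <;>
    simp only [localTrans] at h
  · exact Or.inl ⟨q, σ, q', h⟩
  · exact Or.inr ⟨q, σ, q', h⟩

theorem exists_embedding_unwatched {X : Type*} [Finite X] {m k : ℕ} (ι : Fin k ↪ Fin m)
    (h : Nat.card X + k ≤ m) : ∃ f : X ↪ Fin m, ∀ a i, ι i ≠ f a := by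
  classical
  have := Fintype.ofFinite X
  have hcard : Fintype.card X ≤ Fintype.card {j // ¬ j ∈ Set.range ι} := by
    rw [Fintype.card_subtype_compl]
    have h1 : Fintype.card {j // j ∈ Set.range ι} = k :=
      (Fintype.card_congr (Equiv.ofInjective ι ι.injective).symm).trans (Fintype.card_fin k)
    rw [h1, Fintype.card_fin]
    rw [Nat.card_eq_fintype_card] at h
    omega
  obtain ⟨f⟩ := Function.Embedding.nonempty_of_card_le hcard
  exact ⟨f.trans (Function.Embedding.subtype _), fun a i hi => (f a).2 ⟨i, hi⟩⟩

/-- A fair run of a system with an unobserved `B`-process can be simulated, as far as the observed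
processes are concerned, by a fair run of any system of at least cutoff size. -/
theorem exists_fair_run_holds_iff [Finite QA] [Fintype QB] [Finite SB]
    {A : Template QA SA (Set (QA ⊕ QB))} {B : Template QB SB (Set (QA ⊕ QB))} {n m k : ℕ}
    (hn : k < n) (hm : Fintype.card QB + numG A B + k ≤ m) (ι : Fin k ↪ Fin n) (ι' : Fin k ↪ Fin m)
    (x : Run A B disjSat n) (hx : uncondFair A B disjSat x) :
    ∃ y : Run A B disjSat m, uncondFair A B disjSat y ∧
      ∀ h, LTL.holds (traceK A B disjSat y ι') h 0 ↔ LTL.holds (traceK A B disjSat x ι) h 0 := by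
  classical
  let U := {i : Fin n // ∀ l, ι l ≠ i}
  obtain ⟨u₀⟩ : Nonempty U := by
    by_contra hno
    have hsurj : Function.Surjective ι := by
      intro i
      by_contra! h
      exact hno ⟨⟨i, h⟩⟩
    have := Fintype.card_le_of_surjective ι hsurj
    simp at this
    omega
  let c : U → ℕ → QB × SB := fun u t => ((x.s t).2 u.1, (x.e t).2 u.1)
  let mvd : ℕ → U → Prop := fun t u => x.mv t = some u.1
  have hxstay : ∀ t p, p ≠ x.mv t → view (x.s (t + 1)) p = view (x.s t) p ∧
      inp (x.e (t + 1)) p = inp (x.e t) p :=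
    fun t p hp => ⟨(step_iff.1 (x.steps t)).2 p hp, x.persist t p hp⟩
  have hstay : ∀ t u, ¬ mvd t u → c u (t + 1) = c u t := by
    intro t u hu
    obtain ⟨h1, h2⟩ := hxstay t (some u.1) (Ne.symm hu)
    exact Prod.ext (by simpa [view] using h1) (by simpa [inp] using h2)
  have hxfair : ∀ p, ∃ᶠ t in Filter.atTop, x.mv t = p :=
    fun p => Filter.frequently_atTop.2 (hx p)
  let Vis := {q : QB // ∃ t u, (c u t).1 = q}
  let Rec : QB → Prop := fun q => ∃ᶠ t in Filter.atTop, ∃ u, (c u t).1 = q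
  have hRecVis : ∀ q, Rec q → ∃ t u, (c u t).1 = q := fun q hq => hq.exists
  let v₀ : Vis := ⟨(c u₀ 0).1, 0, u₀, rfl⟩
  obtain ⟨T, hT⟩ : ∃ T, ∀ v : Vis, ∃ t ≤ T, ∃ u, (c u t).1 = v.1 := by
    choose τ hτ using fun v : Vis => v.2
    obtain ⟨T, hT⟩ := (Set.finite_range τ).bddAbove
    exact ⟨T, fun v => ⟨τ v, hT ⟨v, rfl⟩, hτ v⟩⟩
  choose d Mv hcopies hsit hsit' using
    fun v : Vis => exists_copies hstay (fun u => hxfair (some u.1)) (hT v) m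
  let G : Set (Set (QA ⊕ QB)) := ntGuards A ∪ ntGuards B
  obtain ⟨f, hf⟩ := exists_embedding_unwatched (X := QB ⊕ G) ι' (by
    rw [Nat.card_sum, Nat.card_eq_fintype_card, Nat.card_coe_set_eq]
    exact hm)
  have hres : ∀ a : QB ⊕ G, ∃ v : Vis, (∀ w : Vis, a = Sum.inl w.1 → v = w) ∧
      ∀ g : G, a = Sum.inr g → (∃ q, Sum.inr q ∈ g.1 ∧ Rec q) → Sum.inr v.1 ∈ g.1 ∧ Rec v.1 := by
    rintro (q | g)
    · by_cases hq : ∃ t u, (c u t).1 = q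
      · exact ⟨⟨q, hq⟩, fun w hw => Subtype.ext (Sum.inl.inj hw), by simp⟩
      · refine ⟨v₀, fun w hw => absurd w.2 ?_, by simp⟩
        rwa [← Sum.inl.inj hw]
    · by_cases hg : ∃ q, Sum.inr q ∈ g.1 ∧ Rec q
      · obtain ⟨q, hqg, hq⟩ := hg
        refine ⟨⟨q, hRecVis q hq⟩, by simp, fun g' hg' _ => ?_⟩
        obtain rfl := Sum.inr.inj hg'
        exact ⟨hqg, hq⟩
      · refine ⟨v₀, by simp, fun g' hg' h => absurd h ?_⟩
        rwa [← Sum.inr.inj hg']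
  choose res hresl hresr using hres
  have : Nonempty (QB ⊕ G) := ⟨Sum.inl v₀.1⟩
  let tgt : Fin m → Vis := fun j => res (Function.invFun f j)
  have htgt : ∀ a, tgt (f a) = res a :=
    fun a => congrArg res (Function.leftInverse_invFun f.injective a)
  let r : Fin m → Option (Fin k) := Function.partialInv ι'
  have hr : ∀ i j, r j = some i ↔ ι' i = j := ι'.injective.isPartialInv
  have hrι : ∀ i, r (ι' i) = some i := fun i => (hr _ _).2 rfl
  have hrf : ∀ a, r (f a) = none := by
    intro a
    by_contra hne
    obtain ⟨i, hi⟩ := Option.ne_none_iff_exists'.1 hne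
    exact hf a i ((hr _ _).1 hi)
  let b : Fin m → ℕ → QB × SB := fun j t =>
    (r j).elim (d (tgt j) j t) fun i => ((x.s t).2 (ι i), (x.e t).2 (ι i))
  let z : ℕ → GState QA QB m × GInput SA SB m := fun t =>
    (((x.s t).1, fun j => (b j t).1), ((x.e t).1, fun j => (b j t).2))
  let M : ℕ → Proc m → Prop := fun t p =>
    p.elim (x.mv t = none) fun j =>
      (r j).elim (Mv (tgt j) j t) fun i => x.mv t = some (ι i)
  have hb : ∀ j, r j = none → ∀ t, b j t = d (tgt j) j t ∧ (M t (some j) ↔ Mv (tgt j) j t) := by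
    intro j hj t
    simp [b, M, hj]
  have hb' : ∀ j i, r j = some i → ∀ t, b j t = ((x.s t).2 (ι i), (x.e t).2 (ι i)) ∧
      (M t (some j) ↔ x.mv t = some (ι i)) := by
    intro j i hj t
    simp [b, M, hj]
  have hinit : isInit A B (z 0).1 := by
    refine ⟨x.isInit0.1, fun j => ?_⟩
    show (b j 0).1 = B.init
    rcases hj : r j with _ | i
    · obtain ⟨u, hu⟩ := (hcopies (tgt j) j).init
      rw [(hb j hj 0).1, hu]
      exact x.isInit0.2 u.1
    · rw [(hb' j i hj 0).1]
      exact x.isInit0.2 _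
  have hzstay : ∀ t p, ¬ M t p → view (z (t + 1)).1 p = view (z t).1 p ∧
      inp (z (t + 1)).2 p = inp (z t).2 p := by
    rintro t (_ | j) hM
    · exact hxstay t none (Ne.symm hM)
    · suffices h : b j (t + 1) = b j t by simp [view, inp, z, h]
      rcases hj : r j with _ | i
      · rw [(hb j hj _).1, (hb j hj _).1]
        exact (hcopies (tgt j) j).stay t fun h => hM ((hb j hj t).2.2 h)
      · rw [(hb' j i hj _).1, (hb' j i hj _).1]
        obtain ⟨h1, h2⟩ := hxstay t (some (ι i)) fun h => hM ((hb' j i hj t).2.2 h.symm)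
        exact Prod.ext (by simpa [view] using h1) (by simpa [inp] using h2)
  have hcorr : ∀ t p, M t p → view (z t).1 p = view (x.s t) (x.mv t) ∧
      inp (z t).2 p = inp (x.e t) (x.mv t) ∧
      view (z (t + 1)).1 p = view (x.s (t + 1)) (x.mv t) := by
    rintro t (_ | j) hM
    · have hmv : x.mv t = none := hM
      rw [hmv]
      exact ⟨rfl, rfl, rfl⟩
    · rcases hj : r j with _ | i
      · obtain ⟨u, hu, h1, h2⟩ := (hcopies (tgt j) j).copy t ((hb j hj t).2.1 hM)
        have hmv : x.mv t = some u.1 := hu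
        rw [← (hb j hj t).1] at h1
        rw [← (hb j hj (t + 1)).1] at h2
        simp [view, inp, z, hmv, h1, h2, c]
      · have hmv := (hb' j i hj t).2.1 hM
        simp [view, inp, z, hmv, (hb' j i hj t).1, (hb' j i hj (t + 1)).1]
  have hwaitq : ∀ j t, r j = none → ((d (tgt j) j t).1 = (tgt j).1 ∧ ¬ Mv (tgt j) j t) →
      ¬ M t (some j) ∧ view (z t).1 (some j) = Sum.inr (tgt j).1 := by
    rintro j t hj ⟨h1, h2⟩
    rw [(hb j hj t).2]
    refine ⟨h2, ?_⟩
    simp [view, z, (hb j hj t).1, h1]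
  have hguard : ∀ t g, g ∈ guardsOf A ∪ guardsOf B → disjSat (others (x.s t) (x.mv t)) g →
      ∃ p', ¬ M t p' ∧ view (z t).1 p' ∈ g := by
    rintro t g hg ⟨-, ⟨p'', hne, rfl⟩, hpg⟩
    rcases p'' with _ | i
    · exact ⟨none, Ne.symm hne, hpg⟩
    by_cases hi : ∃ l, ι l = i
    · obtain ⟨l, rfl⟩ := hi
      refine ⟨some (ι' l), fun h => hne ((hb' _ l (hrι l) t).2.1 h).symm, ?_⟩
      simpa [view, z, (hb' _ l (hrι l) t).1] using hpg
    push Not at hi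
    let u : U := ⟨i, hi⟩
    let v : Vis := ⟨(c u t).1, t, u, rfl⟩
    by_cases hv : Rec v.1 ∧ T ≤ t
    · by_cases huniv : g = Set.univ
      · subst huniv
        by_cases hA : x.mv t = none
        · refine ⟨some (f (Sum.inl v.1)), fun hM => ?_, trivial⟩
          obtain ⟨u', hu', -⟩ := (hcopies _ _).copy t ((hb _ (hrf _) t).2.1 hM)
          have hmv : x.mv t = some u'.1 := hu'
          simp [hA] at hmv
        · exact ⟨none, hA, trivial⟩
      · have hne' : g ≠ ∅ := by
          rintro rfl
          exact hpg
        let g' : G := ⟨g, hg.imp (fun h => ⟨h, huniv, hne'⟩) fun h => ⟨h, huniv, hne'⟩⟩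
        obtain ⟨hwg, hwRec⟩ := hresr (Sum.inr g') g' rfl ⟨v.1, hpg, hv.1⟩
        have h1 := htgt (Sum.inr g')
        have h2 : tgt (f (Sum.inl (res (Sum.inr g')).1)) = res (Sum.inr g') := by
          rw [htgt]
          exact hresl _ _ rfl
        have hjj : f (Sum.inr g') ≠ f (Sum.inl (res (Sum.inr g')).1) := fun h => by
          simpa using f.injective h
        rcases hsit' _ hwRec t hv.2 _ _ hjj with h | h
        · obtain ⟨h3, h4⟩ := hwaitq (f (Sum.inr g')) t (hrf _) (by rwa [h1])
          exact ⟨_, h3, by rwa [h4, h1]⟩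
        · obtain ⟨h3, h4⟩ := hwaitq _ t (hrf (Sum.inl (res (Sum.inr g')).1)) (by rwa [h2])
          exact ⟨_, h3, by rwa [h4, h2]⟩
    · have h1 : tgt (f (Sum.inl v.1)) = v := by
        rw [htgt]
        exact hresl _ _ rfl
      have h2 := hsit v (f (Sum.inl v.1)) t ⟨u, rfl, fun h => hne (Eq.symm h)⟩
        fun hRec => not_le.1 fun h => hv ⟨hRec, h⟩
      obtain ⟨h3, h4⟩ := hwaitq _ t (hrf (Sum.inl v.1)) (by rwa [h1])
      refine ⟨_, h3, ?_⟩
      rw [h4, h1]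
      exact hpg
  obtain ⟨y, hy, hyh⟩ := exists_run_of_simultaneous ι' z M hinit hzstay
    (fun t p hM => by
      obtain ⟨h1, h2, h3⟩ := hcorr t p hM
      obtain ⟨⟨g, hg, hsat⟩, -⟩ := step_iff.1 (x.steps t)
      exact ⟨g, by rwa [h1, h2, h3], hguard t g hg.mem_guardsOf hsat⟩)
    (by
      rintro (_ | j)
      · exact hxfair none
      · rcases hj : r j with _ | i
        · exact (hcopies (tgt j) j).fair.mono fun t h => (hb j hj t).2.2 h
        · exact (hxfair (some (ι i))).mono fun t h => (hb' j i hj t).2.2 h)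
    (by
      have hcounter : ∀ t p, Watched ι' p → M t p →
          (p = none ∧ x.mv t = none) ∨ ∃ i, p = some (ι' i) ∧ x.mv t = some (ι i) := by
        rintro t p (rfl | ⟨i, rfl⟩) hM
        · exact Or.inl ⟨rfl, hM⟩
        · exact Or.inr ⟨i, rfl, (hb' _ i (hrι i) t).2.1 hM⟩
      intro t p p' hp hp' hM hM'
      rcases hcounter t p hp hM with ⟨rfl, h⟩ | ⟨i, rfl, h⟩ <;>
        rcases hcounter t p' hp' hM' with ⟨rfl, h'⟩ | ⟨i', rfl, h'⟩ <;>
        simp_all)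
  refine ⟨y, hy, fun h => (hyh h).trans ?_⟩
  suffices heq : (fun t => obs ι' (z t)) = traceK A B disjSat x ι by rw [heq]
  funext t
  rw [traceK_eq_obs]
  refine obs_congr ⟨rfl, rfl⟩ fun i => ?_
  have h1 := (hb' _ i (hrι i) t).1
  exact ⟨congrArg Prod.fst h1, congrArg Prod.snd h1⟩



/-- **Disjunctive Cutoff Theorem (k-indexed LTL\X, unconditionally fair executions).**
For disjunctive systems, `|B| + |G| + k` is a cutoff for `k`-indexed `LTL\X` properties
under unconditionally fair executions, where `G = G_A ∪ G_B`. -/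
theorem disjunctive_kindexed_fair_cutoff
    (QA QB SA SB : Type) [Fintype QA] [Fintype QB] [Fintype SA] [Fintype SB]
    (A : Template QA SA (Set (QA ⊕ QB))) (B : Template QB SB (Set (QA ⊕ QB))) (k : ℕ) :
    kCutoff A B disjSat (fun _ x => uncondFair A B disjSat x) k
      (Fintype.card QB + numG A B + k) := by
  have hQB : 0 < Fintype.card QB := Fintype.card_pos_iff.2 ⟨B.init⟩
  have hemb : ∀ {l : ℕ}, Fintype.card QB + numG A B + k ≤ l → Nonempty (Fin k ↪ Fin l) :=
    fun hl => ⟨Fin.castLEEmb (by omega)⟩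
  have hE : ∀ {h : LTL (AtomK QA SA QB SB k)} {n m : ℕ},
      Fintype.card QB + numG A B + k ≤ n → Fintype.card QB + numG A B + k ≤ m →
      satE A B disjSat k n (uncondFair A B disjSat) h →
      satE A B disjSat k m (uncondFair A B disjSat) h := by
    intro h n m hn hm hsat ι'
    obtain ⟨ι⟩ := hemb hn
    obtain ⟨x, hx, hxh⟩ := hsat ι
    obtain ⟨y, hy, hyh⟩ := exists_fair_run_holds_iff (by omega) hm ι ι' x hx
    exact ⟨y, hy, (hyh h).2 hxh⟩
  have hA : ∀ {h : LTL (AtomK QA SA QB SB k)} {n m : ℕ},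
      Fintype.card QB + numG A B + k ≤ n → Fintype.card QB + numG A B + k ≤ m →
      satA A B disjSat k n (uncondFair A B disjSat) h →
      satA A B disjSat k m (uncondFair A B disjSat) h := by
    intro h n m hn hm hsat ι' x hx
    obtain ⟨ι⟩ := hemb hn
    obtain ⟨y, hy, hyh⟩ := exists_fair_run_holds_iff (by omega) hn ι' ι x hx
    exact (hyh h).1 (hsat ι y hy)
  exact fun h n hn => ⟨⟨hE hn le_rfl, hE le_rfl hn⟩, ⟨hA hn le_rfl, hA le_rfl hn⟩⟩
end GP
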